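/- arXiv:2509.24615 — 2 statements merged into one kernel-verified Lean document; each statement's English description precedes it below -/
import Mathlib

section
/- Let Φ : ℝ^q → ℝ^p and R : ℝ^p → ℝ^N be Fréchet differentiable, fix θ₀ ∈ ℝ^q, and set x₀ = Φ(θ₀). Define L_eqn(θ) = (1/N) · Σ_{i=1}^{N} (R_i(Φ(θ)))² and the detached loss L_Dis(θ) = (1/N) · Σ_{i=1}^{N} 2 R_i(x₀) · DR_i(x₀)(Φ(θ)). Then L_Dis and L_eqn have the same Fréchet derivative at θ₀: DL_Dis(θ₀) = DL_eqn(θ₀). Consequently, a gradient-based optimizer applied to L_Dis takes the same step at θ₀ as if it were applied to L_eqn. -/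
open scoped BigOperators

/-- With differentiable `Φ : ℝ^q → ℝ^p`, `R : ℝ^p → ℝ^N`, a fixed
`θ₀` and `x₀ = Φ θ₀`, the true physics loss
`L_eqn θ = (1/N) ∑ i, (R_i(Φ θ))²` and the detached loss
`L_Dis θ = (1/N) ∑ i, 2 R_i(x₀) · DR_i(x₀)(Φ θ)` have the same Fréchet
derivative at `θ₀`. -/
theorem detached_loss_same_derivative (q p N : ℕ)
    (Φ : (Fin q → ℝ) → (Fin p → ℝ)) (R : (Fin p → ℝ) → (Fin N → ℝ))
    (hΦ : Differentiable ℝ Φ) (hR : Differentiable ℝ R)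
    (θ₀ : Fin q → ℝ) (x₀ : Fin p → ℝ) (hx₀ : x₀ = Φ θ₀)
    (Leqn LDis : (Fin q → ℝ) → ℝ)
    (hLeqn : Leqn = fun θ => (1 / (N : ℝ)) * ∑ i, (R (Φ θ) i) ^ 2)
    (hLDis : LDis = fun θ => (1 / (N : ℝ)) *
        ∑ i, 2 * R x₀ i * fderiv ℝ (fun y => R y i) x₀ (Φ θ)) :
    fderiv ℝ LDis θ₀ = fderiv ℝ Leqn θ₀ := by
  subst hx₀ hLeqn hLDis
  have hRi : ∀ i, HasFDerivAt (fun y => R y i) (fderiv ℝ (fun y => R y i) (Φ θ₀)) (Φ θ₀) :=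
    fun i => (differentiableAt_pi.1 (hR (Φ θ₀)) i).hasFDerivAt
  have hΦ₀ := (hΦ θ₀).hasFDerivAt
  have hDis := (HasFDerivAt.fun_sum (u := Finset.univ) fun i _ =>
    (((fderiv ℝ (fun y => R y i) (Φ θ₀)).hasFDerivAt.comp θ₀ hΦ₀).const_mul
      (2 * R (Φ θ₀) i))).const_mul (1 / (N : ℝ))
  have hEqn := (HasFDerivAt.fun_sum (u := Finset.univ) fun i _ =>
    ((hRi i).comp θ₀ hΦ₀).pow 2).const_mul (1 / (N : ℝ))
  refine hDis.fderiv.trans (Eq.trans ?_ hEqn.fderiv.symm)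
  simp
end

section
/- Let Q : ℝ^q → ℝ^{r+s} (the network output, with components (a, b)), ȧ : ℝ^q → ℝ^r, and X : ℝ^{r+s} → ℝ^r all be Fréchet differentiable, fix θ₀ ∈ ℝ^q, and define the residual R(θ) = ȧ(θ) − X(Q(θ)) and the loss L(θ) = (1/N)·Σ_{i=1}^{N} R_i(θ)². Define the mixed detached loss L_Dis,Mom(θ) = (1/N)·Σ_{i=1}^{N} [ 2 R_i(θ₀)·(ȧ_i(θ) − X_i(Q(θ₀))) − 2 R_i(θ₀)·DX_i(Q(θ₀))(Q(θ)) ], in which the factors R_i(θ₀), the value X_i(Q(θ₀)), and the Jacobian DX_i(Q(θ₀)) are treated as constants while ȧ(θ) and Q(θ) remain differentiable functions of θ. Then DL_Dis,Mom(θ₀) = DL(θ₀). -/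
open scoped BigOperators

/-- With differentiable network output `Q : ℝ^q → ℝ^{r+s}`,
AD-computed time derivative `ȧ : ℝ^q → ℝ^r` and detached spatial residual
`X : ℝ^{r+s} → ℝ^r`, residual `R θ = ȧ(θ) − X(Q θ)` and loss
`L θ = (1/r) ∑ i, R_i(θ)²`, the mixed detached loss
`L_Dis,Mom θ = (1/r) ∑ i, (2 R_i(θ₀)(ȧ_i(θ) − X_i(Q θ₀)) − 2 R_i(θ₀) DX_i(Q θ₀)(Q θ))`
— where `R_i(θ₀)`, `X_i(Q θ₀)` and `DX_i(Q θ₀)` are frozen constants while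
`ȧ(θ)` and `Q(θ)` stay in the computational graph — has the same Fréchet
derivative at `θ₀` as `L`. -/
theorem mixed_detached_momentum_loss (q r s : ℕ)
    (Q : (Fin q → ℝ) → (Fin (r + s) → ℝ))
    (adot : (Fin q → ℝ) → (Fin r → ℝ))
    (X : (Fin (r + s) → ℝ) → (Fin r → ℝ))
    (hQ : Differentiable ℝ Q) (hadot : Differentiable ℝ adot)
    (hX : Differentiable ℝ X)
    (θ₀ : Fin q → ℝ)
    (R : (Fin q → ℝ) → (Fin r → ℝ)) (hR : R = fun θ => adot θ - X (Q θ))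
    (L LDisMom : (Fin q → ℝ) → ℝ)
    (hL : L = fun θ => (1 / (r : ℝ)) * ∑ i, (R θ i) ^ 2)
    (hLDisMom : LDisMom = fun θ => (1 / (r : ℝ)) * ∑ i,
        (2 * R θ₀ i * (adot θ i - X (Q θ₀) i)
          - 2 * R θ₀ i * fderiv ℝ (fun y => X y i) (Q θ₀) (Q θ))) :
    fderiv ℝ LDisMom θ₀ = fderiv ℝ L θ₀ := by
  have hQ' : HasFDerivAt Q (fderiv ℝ Q θ₀) θ₀ := (hQ θ₀).hasFDerivAt
  have hadot' (i : Fin r) :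
      HasFDerivAt (fun θ => adot θ i) (fderiv ℝ (fun θ => adot θ i) θ₀) θ₀ :=
    (differentiableAt_pi.1 (hadot θ₀) i).hasFDerivAt
  have hX' (i : Fin r) :
      HasFDerivAt (fun y => X y i) (fderiv ℝ (fun y => X y i) (Q θ₀)) (Q θ₀) :=
    (differentiableAt_pi.1 (hX (Q θ₀)) i).hasFDerivAt
  have hR' (i : Fin r) : HasFDerivAt (fun θ => R θ i)
      (fderiv ℝ (fun θ => adot θ i) θ₀ -
        (fderiv ℝ (fun y => X y i) (Q θ₀)).comp (fderiv ℝ Q θ₀)) θ₀ := by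
    subst hR
    exact (hadot' i).sub ((hX' i).comp θ₀ hQ')
  have hL' := (HasFDerivAt.fun_sum (u := Finset.univ)
    fun i _ => (hR' i).pow 2).const_mul (1 / (r : ℝ))
  have hLDisMom' := (HasFDerivAt.fun_sum (u := Finset.univ)
    fun i _ => (((hadot' i).sub_const (X (Q θ₀) i)).const_mul (2 * R θ₀ i)).sub
      (((fderiv ℝ (fun y => X y i) (Q θ₀)).hasFDerivAt.comp θ₀ hQ').const_mul
        (2 * R θ₀ i))).const_mul (1 / (r : ℝ))
  rw [hL, hLDisMom]
  refine hLDisMom'.fderiv.trans (Eq.trans ?_ hL'.fderiv.symm)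
  congr 1
  refine Finset.sum_congr rfl fun i _ => ?_
  ext v
  simp
  ring
end
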